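/- Raising relation in the first variable index x₁: for every real q with 0 < q < 1, every integer N ≥ 1, all nonzero real numbers θ, φ, all integers n₁, n₂ ≥ 0 with n₁+n₂ ≤ N-1, and all integers x₁, x₂ ≥ 0 with x₁+x₂ ≤ N-1, one has K_{n₁,n₂}(x₁+1,x₂; θ,φ; N) = q^{-1}(1-q^{n₁})(1-θ^{-2}q^{n₁}) K_{n₁-1,n₂}(x₁,x₂; θ,φ; N-1) + q^{-1-n₁}(1-q^{n₂})(1-φ^{-2}q^{n₂}) K_{n₁,n₂-1}(x₁,x₂; θ,φ; N-1) + q^{-n₁-n₂} K_{n₁,n₂}(x₁,x₂; θ,φ; N-1), where by convention K with a negative degree index is 0. -/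

import Mathlib

open Finset

/-- The q-Pochhammer symbol `(a;q)_n = ∏_{k=0}^{n-1} (1 - a q^k)`. -/
noncomputable def qPoch (q a : ℝ) (n : ℕ) : ℝ := ∏ k ∈ Finset.range n, (1 - a * q ^ k)

/-- The quantum q-Krawtchouk polynomial `k_n(x;p,N;q)`, defined for all integers `x, N`. -/
noncomputable def qKraw (q : ℝ) (n : ℕ) (x N : ℤ) (p : ℝ) : ℝ :=
  (-1 : ℝ) ^ n * q ^ (n * (n - 1) / 2) *
    ∑ k ∈ Finset.range (n + 1),
      qPoch q (q ^ (-(n : ℤ))) k * qPoch q (q ^ (-x)) k *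
        qPoch q (q ^ ((k : ℤ) - N)) (n - k) / qPoch q q k * (p * q ^ (n + 1)) ^ k

/-- The bivariate quantum q-Krawtchouk polynomial of Gasper and Rahman,
`K_{n₁,n₂}(x₁,x₂;θ,φ;N) = k_{n₁}(x₁;θ^{-2},x₁+x₂;q) k_{n₂}(x₁+x₂-n₁;φ^{-2},N-n₁;q)`,
with the convention that it vanishes when a degree index is negative. -/
noncomputable def Kq (q : ℝ) (n₁ n₂ x₁ x₂ : ℤ) (θ φ : ℝ) (N : ℤ) : ℝ :=
  if 0 ≤ n₁ ∧ 0 ≤ n₂ then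
    qKraw q n₁.toNat x₁ (x₁ + x₂) (θ ^ 2)⁻¹ *
      qKraw q n₂.toNat (x₁ + x₂ - n₁) (N - n₁) (φ ^ 2)⁻¹
  else 0

/-- The q-trinomial coefficient `[N; x₁, x₂]_q`. -/
noncomputable def qTrinom (q : ℝ) (N x₁ x₂ : ℕ) : ℝ :=
  qPoch q q N / (qPoch q q x₁ * qPoch q q x₂ * qPoch q q (N - x₁ - x₂))

/-- The orthogonality weight `Δ^{(N)}_{x₁,x₂}(θ,φ)`. -/
noncomputable def Δw (q : ℝ) (N x₁ x₂ : ℕ) (θ φ : ℝ) : ℝ :=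
  (-1 : ℝ) ^ (N - x₁) * (θ ^ 2 * q⁻¹) ^ (x₁ + x₂) * q ^ (x₁ * (x₁ - 1) / 2) *
    qTrinom q N x₁ x₂ * qPoch q ((θ ^ 2)⁻¹ * q) x₂ * qPoch q ((φ ^ 2)⁻¹ * q) (N - x₁ - x₂) *
    φ ^ (2 * N) * q ^ (-((N : ℤ) * (N + 1) / 2))

/-- The normalization constant `H^{(N)}_{n₁,n₂}(θ,φ)`. -/
noncomputable def Hn (q : ℝ) (N n₁ n₂ : ℕ) (θ φ : ℝ) : ℝ :=
  (-1 : ℝ) ^ (n₁ + n₂) * qPoch q (q * (θ ^ 2)⁻¹) n₁ * qPoch q (q * (φ ^ 2)⁻¹) n₂ *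
    φ ^ (2 * n₁) * (qPoch q q N / qPoch q q (N - n₁ - n₂)) ^ 2 * (qTrinom q N n₁ n₂)⁻¹ *
    q ^ (3 * ((n₁ : ℤ) * (n₁ - 1)) / 2 + 3 * ((n₂ : ℤ) * (n₂ - 1)) / 2 +
          (n₁ : ℤ) * n₂ - (N : ℤ) * (n₁ + n₂) - 2 * n₁ - n₂)

/-- The dual weight `Δ̃^{(N)}_{n₁,n₂}(θ,φ)`. -/
noncomputable def Δdual (q : ℝ) (N n₁ n₂ : ℕ) (θ φ : ℝ) : ℝ :=
  (-1 : ℝ) ^ (n₁ + n₂) * q ^ (-((n₁ : ℤ) * (n₁ - 1)) - (n₂ : ℤ) * (n₂ - 1)) *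
    φ ^ (-(2 * (n₁ : ℤ))) * (qPoch q q (N - n₁ - n₂) / qPoch q q N) ^ 2 * qTrinom q N n₁ n₂ *
    q ^ ((N : ℤ) * (n₁ + n₂) + 2 * n₁ + n₂ - (n₁ : ℤ) * n₂ -
          (n₁ : ℤ) * (n₁ - 1) / 2 - (n₂ : ℤ) * (n₂ - 1) / 2) /
    (qPoch q (q * (θ ^ 2)⁻¹) n₁ * qPoch q (q * (φ ^ 2)⁻¹) n₂)

theorem qPoch_succ (q a : ℝ) (n : ℕ) : qPoch q a (n + 1) = qPoch q a n * (1 - a * q ^ n) := by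
  simp [qPoch, Finset.prod_range_succ]

theorem qPoch_succ' (q a : ℝ) (n : ℕ) :
    qPoch q a (n + 1) = (1 - a) * qPoch q (q * a) n := by
  simp only [qPoch, Finset.prod_range_succ', pow_zero, mul_one]
  rw [mul_comm]
  congr 1
  refine Finset.prod_congr rfl fun k _ => ?_
  ring

theorem qPoch_self_ne_zero {q : ℝ} (hq0 : 0 < q) (hq1 : q < 1) (n : ℕ) : qPoch q q n ≠ 0 := by
  refine Finset.prod_ne_zero_iff.2 fun k _ => ?_
  rw [← pow_succ']
  exact (sub_pos.2 (pow_lt_one₀ hq0.le hq1 k.succ_ne_zero)).ne'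

/-- The summand of the quantum q-Krawtchouk polynomial, with `a = q ^ (-x)` and `b = q ^ (-N)`
regarded as free variables. -/
noncomputable def qKrawTerm (q p a b : ℝ) (n k : ℕ) : ℝ :=
  qPoch q (q ^ n)⁻¹ k * qPoch q a k * qPoch q (q ^ k * b) (n - k) / qPoch q q k *
    (p * q ^ (n + 1)) ^ k

theorem qKraw_eq_sum_qKrawTerm {q : ℝ} (hq : q ≠ 0) (n : ℕ) (x N : ℤ) (p : ℝ) :
    qKraw q n x N p = (-1) ^ n * q ^ (n * (n - 1) / 2) *
      ∑ k ∈ range (n + 1), qKrawTerm q p (q ^ (-x)) (q ^ (-N)) n k := by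
  simp only [qKraw, qKrawTerm, sub_eq_add_neg, zpow_add₀ hq, zpow_neg, zpow_natCast]

theorem qKrawTerm_succ_self {q : ℝ} (hq : q ≠ 0) (p a b : ℝ) (n : ℕ) :
    qKrawTerm q p a b n (n + 1) = 0 := by
  simp [qKrawTerm, qPoch_succ q (q ^ n)⁻¹, hq]

theorem qKrawTerm_shift_zero {q : ℝ} (hq : q ≠ 0) (p a b : ℝ) (m : ℕ) :
    q ^ (m + 1) * qKrawTerm q p (q⁻¹ * a) (q⁻¹ * b) (m + 1) 0 - qKrawTerm q p a b (m + 1) 0 =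
      -(1 - q ^ (m + 1)) * qKrawTerm q p a b m 0 := by
  have h : qPoch q (q⁻¹ * b) (m + 1) = (1 - q⁻¹ * b) * qPoch q b m := by
    rw [qPoch_succ', mul_inv_cancel_left₀ hq]
  have h0 (c : ℝ) : qPoch q c 0 = 1 := by simp [qPoch]
  simp only [qKrawTerm, h0, pow_zero, one_mul, Nat.sub_zero, h, qPoch_succ q b]
  field_simp
  ring

theorem qKrawTerm_shift_succ {q : ℝ} (hq0 : 0 < q) (hq1 : q < 1) (p a b : ℝ) {m j : ℕ}
    (hj : j ≤ m) :
    q ^ (m + 1) * qKrawTerm q p (q⁻¹ * a) (q⁻¹ * b) (m + 1) (j + 1) -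
        qKrawTerm q p a b (m + 1) (j + 1) =
      -(1 - q ^ (m + 1)) *
        (qKrawTerm q p a b m (j + 1) - p * q ^ (m + 1) * qKrawTerm q p a b m j) := by
  have hq : q ≠ 0 := hq0.ne'
  have hP : qPoch q q j ≠ 0 := qPoch_self_ne_zero hq0 hq1 j
  have hP' : 1 - q * q ^ j ≠ 0 := by
    have := qPoch_self_ne_zero hq0 hq1 (j + 1)
    rw [qPoch_succ] at this
    exact right_ne_zero_of_mul this
  have hn : qPoch q (q ^ (m + 1))⁻¹ (j + 1) =
      (1 - (q ^ (m + 1))⁻¹) * qPoch q (q ^ m)⁻¹ j := by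
    rw [qPoch_succ', pow_succ', mul_inv, mul_inv_cancel_left₀ hq]
  have ha : qPoch q (q⁻¹ * a) (j + 1) = (1 - q⁻¹ * a) * qPoch q a j := by
    rw [qPoch_succ', mul_inv_cancel_left₀ hq]
  have hb : q ^ (j + 1) * (q⁻¹ * b) = q ^ j * b := by
    rw [pow_succ, mul_assoc, mul_inv_cancel_left₀ hq]
  have hp : (p * q ^ (m + 1 + 1)) ^ (j + 1) =
      (p * q ^ (m + 1)) ^ j * q ^ j * (p * q ^ (m + 2)) := by ring
  obtain ⟨d, rfl⟩ := Nat.exists_eq_add_of_le hj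
  rcases d with _ | e
  · rw [add_zero, qKrawTerm_succ_self hq] at *
    simp only [qKrawTerm, hn, ha, hb, hp, qPoch_succ q a, qPoch_succ q q, Nat.sub_self]
    have h0 (c : ℝ) : qPoch q c 0 = 1 := by simp [qPoch]
    simp only [h0]
    generalize (p * q ^ (j + 1)) ^ j = Z
    generalize qPoch q (q ^ j)⁻¹ j = W
    have hu : q ^ j ≠ 0 := pow_ne_zero j hq
    simp only [pow_succ]
    generalize q ^ j = u at hP' hu
    rw [mul_comm] at hP'
    field_simp
    ring
  · have h1 : j + (e + 1) + 1 - (j + 1) = e + 1 := by omega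
    have h2 : j + (e + 1) - (j + 1) = e := by omega
    have h3 : j + (e + 1) - j = e + 1 := by omega
    have hb' : qPoch q (q ^ j * b) (e + 1) = (1 - q ^ j * b) * qPoch q (q ^ (j + 1) * b) e := by
      rw [qPoch_succ', pow_succ', mul_assoc]
    have hp' : (p * q ^ (j + (e + 1) + 1)) ^ (j + 1) =
      (p * q ^ (j + (e + 1) + 1)) ^ j * (p * q ^ (j + (e + 1) + 1)) := pow_succ _ _
    simp only [qKrawTerm, hn, ha, hb, hp, hp', hb', h1, h2, h3, qPoch_succ q a, qPoch_succ q q,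
      qPoch_succ q (q ^ (j + 1) * b), qPoch_succ q (q ^ (j + (e + 1)))⁻¹]
    generalize (p * q ^ (j + (e + 1) + 1)) ^ j = Z
    generalize qPoch q (q ^ (j + (e + 1)))⁻¹ j = W
    generalize qPoch q (q ^ (j + 1) * b) e = B
    field_simp
    ring

theorem sum_qKrawTerm_shift {q : ℝ} (hq0 : 0 < q) (hq1 : q < 1) (p a b : ℝ) (m : ℕ) :
    q ^ (m + 1) * ∑ k ∈ range (m + 2), qKrawTerm q p (q⁻¹ * a) (q⁻¹ * b) (m + 1) k -
        ∑ k ∈ range (m + 2), qKrawTerm q p a b (m + 1) k =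
      -(1 - q ^ (m + 1)) * (1 - p * q ^ (m + 1)) *
        ∑ k ∈ range (m + 1), qKrawTerm q p a b m k := by
  have hT : ∑ k ∈ range (m + 1), qKrawTerm q p a b m k =
      ∑ k ∈ range (m + 1), qKrawTerm q p a b m (k + 1) + qKrawTerm q p a b m 0 := by
    rw [← Finset.sum_range_succ', Finset.sum_range_succ _ (m + 1), qKrawTerm_succ_self hq0.ne',
      add_zero]
  have hS := Finset.sum_congr rfl fun j (hj : j ∈ range (m + 1)) =>
    qKrawTerm_shift_succ hq0 hq1 p a b (Nat.lt_succ_iff.1 (mem_range.1 hj))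
  simp only [Finset.sum_sub_distrib, ← Finset.mul_sum] at hS
  rw [Finset.sum_range_succ', Finset.sum_range_succ' _ (m + 1)]
  linear_combination hS + qKrawTerm_shift_zero hq0.ne' p a b m + (1 - q ^ (m + 1)) * hT

/-- The one-variable raising relation; at `n = 0` the second term vanishes. -/
theorem qKraw_raising {q : ℝ} (hq0 : 0 < q) (hq1 : q < 1) (n : ℕ) (x N : ℤ) (p : ℝ) :
    qKraw q n (x + 1) (N + 1) p =
      q⁻¹ * (1 - q ^ n) * (1 - p * q ^ n) * qKraw q (n - 1) x N p +
        (q ^ n)⁻¹ * qKraw q n x N p := by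
  have hq : q ≠ 0 := hq0.ne'
  rcases n with _ | m
  · simp [qKraw, qPoch]
  · have hz (y : ℤ) : q ^ (-(y + 1)) = q⁻¹ * q ^ (-y) := by
      rw [neg_add, zpow_add₀ hq, zpow_neg_one, mul_comm]
    have hT : (m + 1) * m / 2 = m * (m - 1) / 2 + m := by
      rw [← Finset.sum_range_id, ← Finset.sum_range_succ, Finset.sum_range_id, Nat.add_sub_cancel]
    simp only [qKraw_eq_sum_qKrawTerm hq, hz, Nat.add_sub_cancel, hT]
    have h := sum_qKrawTerm_shift hq0 hq1 p (q ^ (-x)) (q ^ (-N)) m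
    rw [show m + 2 = m + 1 + 1 from rfl] at h
    rw [pow_add q (m * (m - 1) / 2), pow_succ (-1 : ℝ)]
    have hq₁ : q⁻¹ * q ^ (m + 1) = q ^ m := by rw [pow_succ', inv_mul_cancel_left₀ hq]
    have hq₂ : (q ^ (m + 1))⁻¹ * q ^ m = q⁻¹ := by
      rw [pow_succ', mul_inv, inv_mul_cancel_right₀ (pow_ne_zero m hq)]
    generalize ∑ k ∈ range (m + 1 + 1), qKrawTerm q p (q⁻¹ * _) _ (m + 1) k = A at h ⊢
    generalize ∑ k ∈ range (m + 1 + 1), qKrawTerm q p _ _ (m + 1) k = B at h ⊢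
    linear_combination (-1) ^ m * q ^ (m * (m - 1) / 2) * (-q⁻¹ * h + A * hq₁ + B * hq₂)

/-- Raising relation in the first variable index `x₁`
(with the convention that `K` with a negative degree index vanishes). -/
theorem raising_x1 (q : ℝ) (hq0 : 0 < q) (hq1 : q < 1)
    (N : ℕ) (hN : 1 ≤ N) (θ φ : ℝ) (hθ : θ ≠ 0) (hφ : φ ≠ 0)
    (n₁ n₂ : ℕ) (hn : n₁ + n₂ ≤ N - 1) (x₁ x₂ : ℕ) (hx : x₁ + x₂ ≤ N - 1) :
    Kq q n₁ n₂ ((x₁ : ℤ) + 1) x₂ θ φ N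
    = q⁻¹ * (1 - q ^ n₁) * (1 - (θ ^ 2)⁻¹ * q ^ n₁) *
        Kq q ((n₁ : ℤ) - 1) n₂ x₁ x₂ θ φ ((N : ℤ) - 1)
      + q ^ (-1 - (n₁ : ℤ)) * (1 - q ^ n₂) * (1 - (φ ^ 2)⁻¹ * q ^ n₂) *
        Kq q n₁ ((n₂ : ℤ) - 1) x₁ x₂ θ φ ((N : ℤ) - 1)
      + q ^ (-(n₁ : ℤ) - n₂) * Kq q n₁ n₂ x₁ x₂ θ φ ((N : ℤ) - 1) := by
  have hq : q ≠ 0 := hq0.ne'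
  have h₁ := qKraw_raising hq0 hq1 n₁ x₁ (x₁ + x₂) (θ ^ 2)⁻¹
  have h₂ := qKraw_raising hq0 hq1 n₂ (x₁ + x₂ - n₁) (N - 1 - n₁) (φ ^ 2)⁻¹
  have hK₁ : (1 - q ^ n₁) * Kq q ((n₁ : ℤ) - 1) n₂ x₁ x₂ θ φ ((N : ℤ) - 1) =
      (1 - q ^ n₁) * (qKraw q (n₁ - 1) x₁ (x₁ + x₂) (θ ^ 2)⁻¹ *
        qKraw q n₂ (x₁ + x₂ - n₁ + 1) (N - 1 - n₁ + 1) (φ ^ 2)⁻¹) := by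
    rcases n₁ with _ | m
    · simp
    · simp [Kq, show (x₁ : ℤ) + x₂ - m = x₁ + x₂ - (m + 1) + 1 by ring,
        show (N : ℤ) - 1 - m = N - 1 - (m + 1) + 1 by ring]
  have hK₂ : (1 - q ^ n₂) * Kq q n₁ ((n₂ : ℤ) - 1) x₁ x₂ θ φ ((N : ℤ) - 1) =
      (1 - q ^ n₂) * (qKraw q n₁ x₁ (x₁ + x₂) (θ ^ 2)⁻¹ *
        qKraw q (n₂ - 1) (x₁ + x₂ - n₁) (N - 1 - n₁) (φ ^ 2)⁻¹) := by
    rcases n₂ with _ | m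
    · simp
    · simp [Kq]
  have hK : Kq q n₁ n₂ x₁ x₂ θ φ ((N : ℤ) - 1) = qKraw q n₁ x₁ (x₁ + x₂) (θ ^ 2)⁻¹ *
      qKraw q n₂ (x₁ + x₂ - n₁) (N - 1 - n₁) (φ ^ 2)⁻¹ := by
    simp [Kq]
  have hL : Kq q n₁ n₂ ((x₁ : ℤ) + 1) x₂ θ φ N =
      qKraw q n₁ (x₁ + 1) (x₁ + x₂ + 1) (θ ^ 2)⁻¹ *
        qKraw q n₂ (x₁ + x₂ - n₁ + 1) (N - 1 - n₁ + 1) (φ ^ 2)⁻¹ := by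
    simp [Kq, show (x₁ : ℤ) + 1 + x₂ = x₁ + x₂ + 1 by ring,
      show (x₁ : ℤ) + x₂ + 1 - n₁ = x₁ + x₂ - n₁ + 1 by ring,
      show (N : ℤ) - n₁ = N - 1 - n₁ + 1 by ring]
  have hz₁ : q ^ (-1 - (n₁ : ℤ)) = q⁻¹ * (q ^ n₁)⁻¹ := by
    rw [sub_eq_add_neg, zpow_add₀ hq, zpow_neg_one, zpow_neg, zpow_natCast]
  have hz₂ : q ^ (-(n₁ : ℤ) - n₂) = (q ^ n₁)⁻¹ * (q ^ n₂)⁻¹ := by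
    rw [sub_eq_add_neg, zpow_add₀ hq, zpow_neg, zpow_neg, zpow_natCast, zpow_natCast]
  rw [hL, hK, hz₁, hz₂, h₁]
  linear_combination
    (q ^ n₁)⁻¹ * qKraw q n₁ x₁ (x₁ + x₂) (θ ^ 2)⁻¹ * h₂
      - q⁻¹ * (1 - (θ ^ 2)⁻¹ * q ^ n₁) * hK₁
      - q⁻¹ * (q ^ n₁)⁻¹ * (1 - (φ ^ 2)⁻¹ * q ^ n₂) * hK₂
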